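/- Correctness of opening the fuzzy commitment: let p be an odd prime, n a positive natural number, t a natural number, and C ⊆ (ZMod p)^n a set of vectors whose pairwise Lee distances are all at least 2t. Let c ∈ C, let x ∈ (ZMod p)^n, and set δ = x − c. Then for every y ∈ (ZMod p)^n with d_L(y, x) < t, the vector y − δ satisfies d_L(y − δ, c) < t and d_L(y − δ, c') > d_L(y − δ, c) for every codeword c' ∈ C with c' ≠ c; hence c is the unique nearest codeword to y − δ in Lee distance. -/

import Mathlib

/-- The Lee weight of `x : ZMod p`: the minimum of `|x'|` over all integers `x'`
congruent to `x` modulo `p`. -/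
noncomputable def leeWt {p : ℕ} (x : ZMod p) : ℕ :=
  sInf {k : ℕ | ∃ z : ℤ, (z : ZMod p) = x ∧ z.natAbs = k}

/-- The Lee weight of a vector: the sum of the Lee weights of its coordinates. -/
noncomputable def leeWtVec {p n : ℕ} (x : Fin n → ZMod p) : ℕ :=
  ∑ i, leeWt (x i)

/-- The Lee distance of two vectors: the Lee weight of their difference. -/
noncomputable def leeDist {p n : ℕ} (x y : Fin n → ZMod p) : ℕ :=
  leeWtVec (x - y)

/-- Every residue class contains an integer whose absolute value is the Lee weight. -/
theorem exists_intCast_eq_natAbs_eq_leeWt {p : ℕ} (x : ZMod p) :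
    ∃ z : ℤ, (z : ZMod p) = x ∧ z.natAbs = leeWt x :=
  Nat.sInf_mem (s := {k : ℕ | ∃ z : ℤ, (z : ZMod p) = x ∧ z.natAbs = k})
    (let ⟨z, hz⟩ := ZMod.intCast_surjective x; ⟨z.natAbs, z, hz, rfl⟩)

theorem leeWt_intCast_le {p : ℕ} (z : ℤ) : leeWt (z : ZMod p) ≤ z.natAbs :=
  Nat.sInf_le ⟨z, rfl, rfl⟩

theorem leeWt_sub_le {p : ℕ} (x y : ZMod p) : leeWt (x - y) ≤ leeWt x + leeWt y := by
  obtain ⟨a, rfl, ha⟩ := exists_intCast_eq_natAbs_eq_leeWt x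
  obtain ⟨b, rfl, hb⟩ := exists_intCast_eq_natAbs_eq_leeWt y
  rw [← ha, ← hb, ← Int.cast_sub]
  exact (leeWt_intCast_le _).trans (Int.natAbs_sub_le a b)

theorem leeWtVec_sub_le {p n : ℕ} (x y : Fin n → ZMod p) :
    leeWtVec (x - y) ≤ leeWtVec x + leeWtVec y := by
  unfold leeWtVec
  rw [← Finset.sum_add_distrib]
  exact Finset.sum_le_sum fun i _ => leeWt_sub_le (x i) (y i)

theorem leeDist_le_add_left {p n : ℕ} (u v w : Fin n → ZMod p) :
    leeDist v w ≤ leeDist u w + leeDist u v := by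
  simpa [leeDist] using leeWtVec_sub_le (u - w) (u - v)

theorem stmt14 (p n t : ℕ) (hp : p.Prime) (hodd : Odd p) (hn : 0 < n)
    (C : Set (Fin n → ZMod p))
    (hC : ∀ c ∈ C, ∀ c' ∈ C, c ≠ c' → 2 * t ≤ leeDist c c')
    (c : Fin n → ZMod p) (hc : c ∈ C) (x y : Fin n → ZMod p)
    (hy : leeDist y x < t) :
    leeDist (y - (x - c)) c < t ∧
    ∀ c' ∈ C, c' ≠ c → leeDist (y - (x - c)) c < leeDist (y - (x - c)) c' := by
  have hdist : leeDist (y - (x - c)) c = leeDist y x := by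
    unfold leeDist
    congr 1
    abel
  rw [hdist]
  refine ⟨hy, fun c' hc' hne => ?_⟩
  have hsep := hC c hc c' hc' hne.symm
  have htri := leeDist_le_add_left (y - (x - c)) c c'
  omega
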